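/- Let a and b be complex numbers. Then the following identity of formal power series in ℂ⟦z⟧ holds (Bailey's product formula, the q → 1 limit of Theorem 4): (∑_{k=0}^{∞} (a)_k (1−a)_k / k! · z^k) · (∑_{k=0}^{∞} (b)_k (1−b)_k / k! · (−z)^k) = ∑_{m=0}^{∞} [((1+a−b)/2)_m ((1−a+b)/2)_m ((a+b)/2)_m ((2−a−b)/2)_m] / [(1/2)_m m!] (4z²)^m? No — the right-hand side is: ∑_{m=0}^{∞} [((1+a−b)/2)_m ((1−a+b)/2)_m ((a+b)/2)_m ((2−a−b)/2)_m] / [(1/2)_m m!] · 4^m z^{2m} − (a − b)(a + b − 1) · ∑_{m=0}^{∞} [((2+a−b)/2)_m ((2−a+b)/2)_m ((1+a+b)/2)_m ((3−a−b)/2)_m] / [(3/2)_m m!] · 4^m z^{2m+1}. -/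

import Mathlib

/-- The Pochhammer symbol `(x)_k = x (x+1) ⋯ (x+k−1)`. -/
noncomputable def poch (x : ℂ) (k : ℕ) : ℂ := ∏ j ∈ Finset.range k, (x + j)


theorem poch_zero' (x : ℂ) : poch x 0 = 1 := by simp [poch]

theorem poch_succ' (x : ℂ) (k : ℕ) : poch x (k + 1) = poch x k * (x + k) := by
  simp [poch, Finset.prod_range_succ]

/-- coefficient of the left-hand series -/
noncomputable def uu (a : ℂ) (k : ℕ) : ℂ := poch a k * poch (1 - a) k / (k.factorial : ℂ)

/-- coefficient of the second factor -/
noncomputable def vv (b : ℂ) (k : ℕ) : ℂ :=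
  poch b k * poch (1 - b) k / (k.factorial : ℂ) * (-1) ^ k

theorem uu_succ (a : ℂ) (k : ℕ) :
    uu a (k + 1) = (a + k) * (1 - a + k) / (k + 1) * uu a k := by
  have h1 : (k.factorial : ℂ) ≠ 0 := by exact_mod_cast k.factorial_ne_zero
  have h2 : (k : ℂ) + 1 ≠ 0 := by exact_mod_cast k.succ_ne_zero
  simp only [uu, poch_succ', Nat.factorial_succ]
  push_cast
  field_simp

theorem vv_succ (b : ℂ) (k : ℕ) :
    vv b (k + 1) = -((b + k) * (1 - b + k)) / (k + 1) * vv b k := by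
  have h1 : (k.factorial : ℂ) ≠ 0 := by exact_mod_cast k.factorial_ne_zero
  have h2 : (k : ℂ) + 1 ≠ 0 := by exact_mod_cast k.succ_ne_zero
  simp only [vv, poch_succ', Nat.factorial_succ, pow_succ]
  push_cast
  field_simp

/-- the polynomial of the recurrence -/
noncomputable def PP (a b N : ℂ) : ℂ :=
  (N + a - b) * (N - a + b) * (N - 1 + a + b) * (N + 1 - a - b)

/-- the certificate polynomial -/
noncomputable def ss (a b N k : ℂ) : ℂ :=
  b * (1 - b) * (2 * N + 1 - k) - (N + 1 - k) * (a * (1 - a) + N * (2 * N + 1 - k))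

/-- the certificate -/
noncomputable def GG (a b : ℂ) (n k : ℕ) : ℂ :=
  k * ss a b (n + 1) k * uu a k * vv b (n + 1 - k) / (n + 2 - k)

theorem cert (a b : ℂ) (n k : ℕ) (hk : k ≤ n) :
    ((n : ℂ) + 1) * (n + 2) * (uu a k * vv b (n + 2 - k)) -
      PP a b (n + 1) * (uu a k * vv b (n - k)) = GG a b n (k + 1) - GG a b n k := by
  obtain ⟨j, rfl⟩ := Nat.exists_eq_add_of_le hk
  have e1 : k + j + 2 - k = j + 1 + 1 := by omega
  have e2 : k + j - k = j := by omega
  have e3 : k + j + 1 - k = j + 1 := by omega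
  have e4 : k + j + 1 - (k + 1) = j := by omega
  have h1 : (k : ℂ) + 1 ≠ 0 := by exact_mod_cast k.succ_ne_zero
  have h2 : (j : ℂ) + 1 ≠ 0 := by exact_mod_cast j.succ_ne_zero
  have h3 : (j : ℂ) + 2 ≠ 0 := by exact_mod_cast (j+1).succ_ne_zero
  have h3' : (j : ℂ) + 1 + 1 ≠ 0 := by exact_mod_cast (j+1).succ_ne_zero
  simp only [GG, e1, e2, e3, e4, uu_succ, vv_succ]
  push_cast
  have d1 : (k : ℂ) + j + 2 - (k + 1) = j + 1 := by ring
  have d2 : (k : ℂ) + j + 2 - k = j + 2 := by ring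
  rw [d1, d2, show (j : ℂ) + 1 + 1 = j + 2 by ring]
  generalize uu a k = U
  generalize vv b j = V
  field_simp
  simp only [PP, ss]
  ring

/-- the product coefficients -/
noncomputable def cc (a b : ℂ) (n : ℕ) : ℂ :=
  ∑ k ∈ Finset.range (n + 1), uu a k * vv b (n - k)

theorem cc_rec (a b : ℂ) (n : ℕ) :
    ((n : ℂ) + 1) * (n + 2) * cc a b (n + 2) = PP a b (n + 1) * cc a b n := by
  have hs : ∑ k ∈ Finset.range (n + 1), (((n : ℂ) + 1) * (n + 2) * (uu a k * vv b (n + 2 - k)) -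
      PP a b (n + 1) * (uu a k * vv b (n - k))) = GG a b n (n + 1) - GG a b n 0 := by
    rw [← Finset.sum_range_sub]
    apply Finset.sum_congr rfl
    intro k hk
    exact cert a b n k (by have := Finset.mem_range.1 hk; omega)
  rw [Finset.sum_sub_distrib, ← Finset.mul_sum, ← Finset.mul_sum] at hs
  have h1 : (n : ℂ) + 1 + 1 ≠ 0 := by exact_mod_cast (n+1).succ_ne_zero
  have h2 : (n : ℂ) + 1 ≠ 0 := by exact_mod_cast n.succ_ne_zero
  have hb : ((n : ℂ) + 1) * (n + 2) *
      (uu a (n + 1) * vv b 1 + uu a (n + 2) * vv b 0) + GG a b n (n + 1) - GG a b n 0 = 0 := by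
    have hv0 : vv b 0 = 1 := by simp [vv, poch_zero']
    have hv1 : vv b 1 = -(b * (1 - b)) := by rw [vv_succ, hv0]; simp
    have e : (n : ℂ) + 2 - (n + 1) = 1 := by ring
    simp only [GG, Nat.sub_self, hv0, hv1, uu_succ a (n + 1), ss]
    push_cast
    rw [e]
    field_simp
    ring
  unfold cc
  rw [Finset.sum_range_succ, Finset.sum_range_succ, show n + 2 - (n + 1) = 1 by omega,
    Nat.sub_self]
  linear_combination hs + hb

/-- the right-hand coefficients -/
noncomputable def rr (a b : ℂ) (n : ℕ) : ℂ :=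
  if n % 2 = 0 then
          poch ((1 + a - b) / 2) (n / 2) * poch ((1 - a + b) / 2) (n / 2) *
              poch ((a + b) / 2) (n / 2) * poch ((2 - a - b) / 2) (n / 2) /
            (poch (1 / 2) (n / 2) * ((n / 2).factorial : ℂ)) * 4 ^ (n / 2)
        else
          -((a - b) * (a + b - 1)) *
            (poch ((2 + a - b) / 2) (n / 2) * poch ((2 - a + b) / 2) (n / 2) *
                poch ((1 + a + b) / 2) (n / 2) * poch ((3 - a - b) / 2) (n / 2) /
              (poch (3 / 2) (n / 2) * ((n / 2).factorial : ℂ)) * 4 ^ (n / 2))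

theorem poch_ne (x : ℝ) (hx : 0 < x) (m : ℕ) : poch (x : ℂ) m ≠ 0 := by
  unfold poch
  refine Finset.prod_ne_zero_iff.2 fun j _ => ?_
  have : x + j ≠ 0 := by positivity
  exact_mod_cast this

theorem rr_rec (a b : ℂ) (n : ℕ) :
    ((n : ℂ) + 1) * (n + 2) * rr a b (n + 2) = PP a b (n + 1) * rr a b n := by
  have p1 (m : ℕ) : poch (1 / 2) m ≠ 0 := by
    have := poch_ne (1 / 2) (by norm_num) m
    push_cast at this
    exact this
  have p3 (m : ℕ) : poch (3 / 2) m ≠ 0 := by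
    have := poch_ne (3 / 2) (by norm_num) m
    push_cast at this
    exact this
  obtain ⟨m, rfl | rfl⟩ := n.even_or_odd'
  · have e1 : (2 * m + 2) % 2 = 0 := by omega
    have e2 : (2 * m) % 2 = 0 := by omega
    have e3 : (2 * m + 2) / 2 = m + 1 := by omega
    have e4 : (2 * m) / 2 = m := by omega
    have h1 : (m.factorial : ℂ) ≠ 0 := by exact_mod_cast m.factorial_ne_zero
    have h2 : (m : ℂ) + 1 ≠ 0 := by exact_mod_cast m.succ_ne_zero
    have h3 : 1 + (m : ℂ) * 2 ≠ 0 := by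
      have : 1 + m * 2 ≠ 0 := by omega
      exact_mod_cast this
    have h4 : (1 : ℂ) / 2 + m ≠ 0 := by
      intro h; apply h3; linear_combination 2 * h
    have hp := p1 m
    simp only [rr, e1, e2, e3, e4, if_true, poch_succ', Nat.factorial_succ, pow_succ, PP]
    push_cast
    generalize poch (1 / 2) m = X at *
    generalize poch ((1 + a - b) / 2) m = X1 at *
    generalize poch ((1 - a + b) / 2) m = X2 at *
    generalize poch ((a + b) / 2) m = X3 at *
    generalize poch ((2 - a - b) / 2) m = X4 at *
    have h5 : 1 + 2 * (m : ℂ) ≠ 0 := by rwa [mul_comm] at h3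
    have h6 : 2 * (m : ℂ) + 1 ≠ 0 := by rwa [add_comm] at h5
    rw [show (1 : ℂ) / 2 + m = (1 + 2 * m) / 2 by ring]
    field_simp
    ring
  · have e1 : ¬ (2 * m + 1 + 2) % 2 = 0 := by omega
    have e2 : ¬ (2 * m + 1) % 2 = 0 := by omega
    have e3 : (2 * m + 1 + 2) / 2 = m + 1 := by omega
    have e4 : (2 * m + 1) / 2 = m := by omega
    have h1 : (m.factorial : ℂ) ≠ 0 := by exact_mod_cast m.factorial_ne_zero
    have h2 : (m : ℂ) + 1 ≠ 0 := by exact_mod_cast m.succ_ne_zero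
    have h3 : 3 + (m : ℂ) * 2 ≠ 0 := by
      have : 3 + m * 2 ≠ 0 := by omega
      exact_mod_cast this
    have hp := p3 m
    simp only [rr, e1, e2, e3, e4, if_false, poch_succ', Nat.factorial_succ, pow_succ, PP]
    push_cast
    generalize poch (3 / 2) m = X at *
    generalize poch ((2 + a - b) / 2) m = X1 at *
    generalize poch ((2 - a + b) / 2) m = X2 at *
    generalize poch ((1 + a + b) / 2) m = X3 at *
    generalize poch ((3 - a - b) / 2) m = X4 at *
    have h5 : 3 + 2 * (m : ℂ) ≠ 0 := by rwa [mul_comm] at h3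
    have h6 : 2 * (m : ℂ) + 3 ≠ 0 := by rwa [add_comm] at h5
    rw [show (3 : ℂ) / 2 + m = (3 + 2 * m) / 2 by ring]
    field_simp
    ring

theorem cc_eq_rr (a b : ℂ) (n : ℕ) : cc a b n = rr a b n ∧ cc a b (n + 1) = rr a b (n + 1) := by
  induction n with
  | zero =>
    constructor
    · simp [cc, rr, uu, vv, poch_zero']
    · simp [cc, rr, uu, vv, poch_zero', Finset.sum_range_succ, poch]
      ring
  | succ n ih =>
    refine ⟨ih.2, ?_⟩
    have h1 : (n : ℂ) + 1 ≠ 0 := by exact_mod_cast n.succ_ne_zero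
    have h2 : (n : ℂ) + 2 ≠ 0 := by exact_mod_cast (n+1).succ_ne_zero
    apply mul_left_cancel₀ (mul_ne_zero h1 h2)
    have h3 := cc_rec a b n
    have h4 := rr_rec a b n
    rw [ih.1] at h3
    exact h3.trans h4.symm

/-- Bailey's product formula, the `q → 1` limit of Theorem 4, as an identity of formal
power series in `ℂ⟦z⟧`:
`₂F₀[a, 1−a; —; z] · ₂F₀[b, 1−b; —; −z]
  = ₄F₁[(1+a−b)/2, (1−a+b)/2, (a+b)/2, (2−a−b)/2; 1/2; 4z²]
    − (a−b)(a+b−1) z · ₄F₁[(2+a−b)/2, (2−a+b)/2, (1+a+b)/2, (3−a−b)/2; 3/2; 4z²]`;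
the coefficient of `z^{2m}` on the right is the `m`-th term of the first `₄F₁` with
`4^m`, and the coefficient of `z^{2m+1}` is `−(a−b)(a+b−1)` times the `m`-th term of
the second `₄F₁` with `4^m`. -/
theorem bailey_product_2F0 (a b : ℂ) :
    (PowerSeries.mk fun k : ℕ => poch a k * poch (1 - a) k / (k.factorial : ℂ)) *
        (PowerSeries.mk fun k : ℕ =>
          poch b k * poch (1 - b) k / (k.factorial : ℂ) * (-1) ^ k) =
      PowerSeries.mk fun n : ℕ =>
        if n % 2 = 0 then
          poch ((1 + a - b) / 2) (n / 2) * poch ((1 - a + b) / 2) (n / 2) *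
              poch ((a + b) / 2) (n / 2) * poch ((2 - a - b) / 2) (n / 2) /
            (poch (1 / 2) (n / 2) * ((n / 2).factorial : ℂ)) * 4 ^ (n / 2)
        else
          -((a - b) * (a + b - 1)) *
            (poch ((2 + a - b) / 2) (n / 2) * poch ((2 - a + b) / 2) (n / 2) *
                poch ((1 + a + b) / 2) (n / 2) * poch ((3 - a - b) / 2) (n / 2) /
              (poch (3 / 2) (n / 2) * ((n / 2).factorial : ℂ)) * 4 ^ (n / 2)) := by
  ext n
  rw [PowerSeries.coeff_mul, PowerSeries.coeff_mk,
    Finset.Nat.sum_antidiagonal_eq_sum_range_succ_mk]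
  simp only [PowerSeries.coeff_mk]
  exact (cc_eq_rr a b n).1
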